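/- arXiv:1805.12527 — 5 statements merged into one kernel-verified Lean document; each statement's English description precedes it below -/
import Mathlib

section
/- The following identity between convergent series of positive rationals holds: 2·Σ_{i=2}^∞ 1/(4i² − 1) + Σ_{i=1}^∞ 1/((2i−1)²(2i+3)²) + Σ_{i=0}^∞ ((i+2)² + (i+1)²)/((2i+1)(2i+5)(2i+3)²) = 5/9. -/
open Filter Topology in
/-- A telescoping series `∑ (F n - F (n + 1))` of nonnegative terms with `F → 0` sums to `F 0`. -/
theorem hasSum_sub_succ_of_tendsto_zero {f F : ℕ → ℝ} (hf : ∀ n, 0 ≤ f n)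
    (hF : ∀ n, f n = F n - F (n + 1)) (hlim : Tendsto F atTop (𝓝 0)) : HasSum f (F 0) := by
  rw [hasSum_iff_tendsto_nat_of_nonneg hf]
  simp_rw [hF, Finset.sum_range_sub']
  simpa using hlim.const_sub (F 0)

open Filter Topology in
theorem tendsto_inv_two_mul_add_atTop (c : ℝ) :
    Tendsto (fun n : ℕ => 1 / (2 * (n : ℝ) + c)) atTop (𝓝 0) := by
  simp_rw [one_div]
  exact tendsto_inv_atTop_zero.comp (tendsto_atTop_add_const_right _ _
    (tendsto_natCast_atTop_atTop.const_mul_atTop two_pos))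


/-- `2·Σ_{i=2}^∞ 1/(4i²−1) + Σ_{i=1}^∞ 1/((2i−1)²(2i+3)²)
    + Σ_{i=0}^∞ ((i+2)²+(i+1)²)/((2i+1)(2i+5)(2i+3)²) = 5/9`. -/
theorem series_identity_five_ninths :
    2 * (∑' i : ℕ, (1 : ℝ) / (4 * ((i : ℝ) + 2) ^ 2 - 1)) +
      (∑' i : ℕ, (1 : ℝ) /
        ((2 * ((i : ℝ) + 1) - 1) ^ 2 * (2 * ((i : ℝ) + 1) + 3) ^ 2)) +
      (∑' i : ℕ, (((i : ℝ) + 2) ^ 2 + ((i : ℝ) + 1) ^ 2) /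
        ((2 * (i : ℝ) + 1) * (2 * (i : ℝ) + 5) * (2 * (i : ℝ) + 3) ^ 2)) =
      5 / 9 := by
  set f : ℕ → ℝ := fun i => 1 / (4 * ((i : ℝ) + 2) ^ 2 - 1) with hf
  set g : ℕ → ℝ := fun i => 1 /
    ((2 * ((i : ℝ) + 1) - 1) ^ 2 * (2 * ((i : ℝ) + 1) + 3) ^ 2) with hg
  set h : ℕ → ℝ := fun i => (((i : ℝ) + 2) ^ 2 + ((i : ℝ) + 1) ^ 2) /
    ((2 * (i : ℝ) + 1) * (2 * (i : ℝ) + 5) * (2 * (i : ℝ) + 3) ^ 2) with hh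
  have f_nonneg (i) : 0 ≤ f i := by
    have : (0 : ℝ) ≤ i := i.cast_nonneg
    exact div_nonneg zero_le_one (by nlinarith)
  have g_nonneg (i) : 0 ≤ g i := by positivity
  have h_nonneg (i) : 0 ≤ h i := by positivity
  set F : ℕ → ℝ := fun i => 9 / 8 * (1 / (2 * (i : ℝ) + 3)) + 1 / 8 * (1 / (2 * (i : ℝ) + 1)) +
    1 / 16 * ((1 / (2 * (i : ℝ) + 1)) ^ 2 - (1 / (2 * (i : ℝ) + 3)) ^ 2) with hF
  have telescope (i) : 2 * f i + g i + h i = F i - F (i + 1) := by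
    have e₁ : 4 * ((i : ℝ) + 2) ^ 2 - 1 = (2 * i + 3) * (2 * i + 5) := by ring
    have e₂ : 2 * ((i : ℝ) + 1) - 1 = 2 * i + 1 := by ring
    have e₃ : 2 * ((i : ℝ) + 1) + 3 = 2 * i + 5 := by ring
    have e₄ : 2 * ((i : ℝ) + 1) + 1 = 2 * i + 3 := by ring
    simp only [hf, hg, hh, hF, Nat.cast_add, Nat.cast_one, e₁, e₂, e₃, e₄]
    field_simp
    ring
  have F_lim : Filter.Tendsto F Filter.atTop (nhds 0) := by
    have h₁ := tendsto_inv_two_mul_add_atTop 1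
    have h₃ := tendsto_inv_two_mul_add_atTop 3
    simpa [hF, -one_div] using ((h₃.const_mul (9 / 8)).add (h₁.const_mul (1 / 8))).add
      (((h₁.pow 2).sub (h₃.pow 2)).const_mul (1 / 16))
  have total : HasSum (fun i => 2 * f i + g i + h i) (F 0) :=
    hasSum_sub_succ_of_tendsto_zero
      (fun i => by linarith [f_nonneg i, g_nonneg i, h_nonneg i]) telescope F_lim
  have f_sum : Summable f := .of_nonneg_of_le f_nonneg
    (fun i => by linarith [f_nonneg i, g_nonneg i, h_nonneg i]) total.summable
  have g_sum : Summable g := .of_nonneg_of_le g_nonneg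
    (fun i => by linarith [f_nonneg i, g_nonneg i, h_nonneg i]) total.summable
  have h_sum : Summable h := .of_nonneg_of_le h_nonneg
    (fun i => by linarith [f_nonneg i, g_nonneg i, h_nonneg i]) total.summable
  rw [(((f_sum.hasSum.mul_left 2).add g_sum.hasSum).add h_sum.hasSum).unique total]
  norm_num [hF]
end

section
/- The following identity between convergent series of positive rationals holds: Σ_{i=0}^∞ 1/((2i+1)(2i+5)(2i+3)²) + 2·Σ_{i=1}^∞ 1/((2i−1)²(2i+3)²) = 1/9. -/
/-- A nonnegative sequence that is the difference of consecutive terms of a null sequence `u`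
sums to `u 0`. -/
theorem hasSum_of_nonneg_of_eq_sub_succ {f u : ℕ → ℝ} (hf : ∀ i, 0 ≤ f i)
    (hfu : ∀ i, f i = u i - u (i + 1)) (hu : Filter.Tendsto u Filter.atTop (nhds 0)) :
    HasSum f (u 0) := by
  rw [hasSum_iff_tendsto_nat_of_nonneg hf]
  simp only [hfu, Finset.sum_range_sub']
  simpa using hu.const_sub (u 0)

theorem tendsto_one_div_two_mul_add_sq_atTop (c : ℝ) :
    Filter.Tendsto (fun i : ℕ => 1 / (2 * (i : ℝ) + c) ^ 2) Filter.atTop (nhds 0) := by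
  have h : Filter.Tendsto (fun i : ℕ => 2 * (i : ℝ) + c) Filter.atTop Filter.atTop :=
    Filter.tendsto_atTop_add_const_right _ _
      (tendsto_natCast_atTop_atTop.const_mul_atTop two_pos)
  simp only [one_div]
  exact ((Filter.tendsto_pow_atTop two_ne_zero).comp h).inv_tendsto_atTop

/-- `Σ_{i=0}^∞ 1/((2i+1)(2i+5)(2i+3)²) + 2·Σ_{i=1}^∞ 1/((2i−1)²(2i+3)²) = 1/9`. -/
theorem series_identity_one_ninth :
    (∑' i : ℕ, (1 : ℝ) /
        ((2 * (i : ℝ) + 1) * (2 * (i : ℝ) + 5) * (2 * (i : ℝ) + 3) ^ 2)) +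
      2 * (∑' i : ℕ, (1 : ℝ) /
        ((2 * ((i : ℝ) + 1) - 1) ^ 2 * (2 * ((i : ℝ) + 1) + 3) ^ 2)) =
      1 / 9 := by
  set f : ℕ → ℝ := fun i =>
    1 / ((2 * (i : ℝ) + 1) * (2 * (i : ℝ) + 5) * (2 * (i : ℝ) + 3) ^ 2) with hf
  set g : ℕ → ℝ := fun i =>
    1 / ((2 * ((i : ℝ) + 1) - 1) ^ 2 * (2 * ((i : ℝ) + 1) + 3) ^ 2) with hg
  let u : ℕ → ℝ := fun i => 1 / 8 * (1 / (2 * (i : ℝ) + 1) ^ 2 - 1 / (2 * (i : ℝ) + 3) ^ 2)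
  have f_nonneg (i : ℕ) : 0 ≤ f i := by positivity
  have g_nonneg (i : ℕ) : 0 ≤ g i := by positivity
  have hfg (i : ℕ) : f i + 2 * g i = u i - u (i + 1) := by
    have e₁ : 2 * ((i : ℝ) + 1) - 1 = 2 * i + 1 := by ring
    have e₂ : 2 * ((i : ℝ) + 1) + 1 = 2 * i + 3 := by ring
    have e₃ : 2 * ((i : ℝ) + 1) + 3 = 2 * i + 5 := by ring
    simp only [hf, hg, u, Nat.cast_add, Nat.cast_one, e₁, e₂, e₃]
    field_simp
    ring
  have hu : Filter.Tendsto u Filter.atTop (nhds 0) := by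
    simpa [u] using ((tendsto_one_div_two_mul_add_sq_atTop 1).sub
      (tendsto_one_div_two_mul_add_sq_atTop 3)).const_mul (1 / 8 : ℝ)
  have hsum : HasSum (fun i => f i + 2 * g i) (u 0) :=
    hasSum_of_nonneg_of_eq_sub_succ
      (fun i => add_nonneg (f_nonneg i) (mul_nonneg zero_le_two (g_nonneg i))) hfg hu
  have f_summable : Summable f :=
    hsum.summable.of_nonneg_of_le f_nonneg fun i => by linarith [g_nonneg i]
  have g_summable : Summable g :=
    hsum.summable.of_nonneg_of_le g_nonneg fun i => by linarith [f_nonneg i, g_nonneg i]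
  rw [← tsum_mul_left, ← f_summable.tsum_add (g_summable.mul_left 2), hsum.tsum_eq]
  norm_num [u]
end

section
/- Let Pₙ : ℝ → ℝ be defined by the Rodrigues formula Pₙ(x) = (1/(2ⁿ n!)) · (dⁿ/dxⁿ)(x² − 1)ⁿ. Then for all m, n ∈ ℕ, ∫_{−1}^{1} P_m(x) P_n(x) dx = 2/(2n+1) if m = n, and = 0 if m ≠ n. -/
/-- The Legendre polynomial via the Rodrigues formula. -/
noncomputable def legendreP (n : ℕ) (x : ℝ) : ℝ :=
  (1 / (2 ^ n * (Nat.factorial n : ℝ))) *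
    iteratedDeriv n (fun y : ℝ => (y ^ 2 - 1) ^ n) x

open Polynomial in
theorem Polynomial.iteratedDeriv_eval (p : ℝ[X]) (n : ℕ) :
    iteratedDeriv n (fun x => p.eval x) = fun x => (derivative^[n] p).eval x := by
  induction n with
  | zero => simp
  | succ n ih =>
    ext x
    rw [iteratedDeriv_succ, ih, Polynomial.deriv, Function.iterate_succ_apply']

open Polynomial in
theorem Polynomial.Monic.iterate_derivative_natDegree {R : Type*} [Semiring R] {p : R[X]}
    (hp : p.Monic) : derivative^[p.natDegree] p = C (p.natDegree.factorial : R) := by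
  have h : (derivative^[p.natDegree] p).natDegree = 0 := by
    simpa using natDegree_iterate_derivative p p.natDegree
  rw [eq_C_of_natDegree_eq_zero h, coeff_iterate_derivative]
  simp [Nat.descFactorial_self, hp.coeff_natDegree]

open Polynomial in
theorem Polynomial.intervalIntegrable_eval (p : ℝ[X]) (a b : ℝ) :
    IntervalIntegrable (fun x => p.eval x) MeasureTheory.volume a b :=
  p.continuous.intervalIntegrable a b

open Polynomial in
/-- Repeated integration by parts against a polynomial vanishing to order `k` at `±1`. -/
theorem Polynomial.integral_mul_iterate_derivative (k : ℕ) (p q : ℝ[X])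
    (hq : (X ^ 2 - 1) ^ k ∣ q) :
    ∫ x in (-1 : ℝ)..1, p.eval x * (derivative^[k] q).eval x =
      (-1) ^ k * ∫ x in (-1 : ℝ)..1, (derivative^[k] p).eval x * q.eval x := by
  induction k generalizing p with
  | zero => simp
  | succ k ih =>
    have hdvd : X ^ 2 - 1 ∣ derivative^[k] q := by
      simpa using pow_sub_dvd_iterate_derivative_of_pow_dvd k hq
    obtain ⟨r, hr⟩ := hdvd
    rw [Function.iterate_succ_apply', Function.iterate_succ_apply,
      intervalIntegral.integral_mul_deriv_eq_deriv_mul (fun x _ => p.hasDerivAt x)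
        (fun x _ => (derivative^[k] q).hasDerivAt x) (intervalIntegrable_eval _ _ _)
        (intervalIntegrable_eval _ _ _),
      ih _ ((pow_dvd_pow _ k.le_succ).trans hq), hr]
    simp [pow_succ]

theorem integral_sq_sub_one_pow_succ (n : ℕ) :
    (2 * (n : ℝ) + 3) * ∫ x in (-1 : ℝ)..1, (x ^ 2 - 1) ^ (n + 1) =
      -(2 * (n + 1)) * ∫ x in (-1 : ℝ)..1, (x ^ 2 - 1) ^ n := by
  have hderiv (x : ℝ) : HasDerivAt (fun y : ℝ => y * (y ^ 2 - 1) ^ (n + 1))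
      ((2 * (n : ℝ) + 3) * (x ^ 2 - 1) ^ (n + 1) + 2 * (n + 1) * (x ^ 2 - 1) ^ n) x := by
    refine ((hasDerivAt_id' x).fun_mul
      ((((hasDerivAt_id' x).fun_pow 2).sub_const 1).fun_pow (n + 1))).congr_deriv ?_
    push_cast
    ring
  have hintegrable (c : ℝ) (k : ℕ) : IntervalIntegrable (fun x : ℝ => c * (x ^ 2 - 1) ^ k)
      MeasureTheory.volume (-1) 1 := Continuous.intervalIntegrable (by fun_prop) _ _
  have h := intervalIntegral.integral_eq_sub_of_hasDerivAt (fun x _ => hderiv x)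
    ((hintegrable _ _).add (hintegrable _ _))
  rw [intervalIntegral.integral_add (hintegrable _ _) (hintegrable _ _),
    intervalIntegral.integral_const_mul, intervalIntegral.integral_const_mul] at h
  norm_num at h
  linarith

theorem integral_sq_sub_one_pow (n : ℕ) :
    ∫ x in (-1 : ℝ)..1, (x ^ 2 - 1) ^ n =
      (-1) ^ n * 2 ^ (2 * n + 1) * (n.factorial : ℝ) ^ 2 / ((2 * n + 1).factorial : ℝ) := by
  induction n with
  | zero => norm_num
  | succ n ih =>
    have h := integral_sq_sub_one_pow_succ n
    have hfac : ((2 * (n + 1) + 1).factorial : ℝ) =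
        (2 * n + 3) * (2 * (n + 1)) * ((2 * n + 1).factorial : ℝ) := by
      rw [show 2 * (n + 1) + 1 = 2 * n + 1 + 1 + 1 by ring, Nat.factorial_succ,
        Nat.factorial_succ]
      push_cast
      ring
    have hn : (2 * (n : ℝ) + 3) ≠ 0 := by positivity
    apply mul_left_cancel₀ hn
    rw [h, ih, hfac, Nat.factorial_succ n]
    push_cast
    field_simp
    ring

open Polynomial in
theorem legendreP_eq_eval (n : ℕ) (x : ℝ) :
    legendreP n x = 1 / (2 ^ n * (n.factorial : ℝ)) *
      (derivative^[n] ((X ^ 2 - 1) ^ n : ℝ[X])).eval x := by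
  have h := congrFun (Polynomial.iteratedDeriv_eval ((X ^ 2 - 1) ^ n) n) x
  simp only [eval_pow, eval_sub, eval_X, eval_one] at h
  rw [legendreP, h]

open Polynomial in
theorem integral_legendreP_mul (m n : ℕ) :
    ∫ x in (-1 : ℝ)..1, legendreP m x * legendreP n x =
      1 / (2 ^ m * (m.factorial : ℝ)) * (1 / (2 ^ n * (n.factorial : ℝ))) * ((-1) ^ n *
        ∫ x in (-1 : ℝ)..1,
          (derivative^[n + m] ((X ^ 2 - 1) ^ m : ℝ[X])).eval x * (x ^ 2 - 1) ^ n) := by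
  have h := integral_mul_iterate_derivative n (derivative^[m] ((X ^ 2 - 1) ^ m))
    ((X ^ 2 - 1) ^ n) dvd_rfl
  simp only [← Function.iterate_add_apply, eval_pow, eval_sub, eval_X, eval_one] at h
  rw [← h, ← intervalIntegral.integral_const_mul]
  congr 1
  ext x
  rw [legendreP_eq_eval, legendreP_eq_eval]
  ring

open Polynomial in
theorem natDegree_X_sq_sub_one_pow (n : ℕ) : ((X ^ 2 - 1) ^ n : ℝ[X]).natDegree = 2 * n := by
  rw [natDegree_pow, ← C_1, natDegree_X_pow_sub_C, mul_comm]

theorem integral_legendreP_mul_of_lt {m n : ℕ} (h : m < n) :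
    ∫ x in (-1 : ℝ)..1, legendreP m x * legendreP n x = 0 := by
  rw [integral_legendreP_mul, Polynomial.iterate_derivative_eq_zero]
  · simp
  · rw [natDegree_X_sq_sub_one_pow]
    lia

open Polynomial in
theorem integral_legendreP_mul_self (n : ℕ) :
    ∫ x in (-1 : ℝ)..1, legendreP n x * legendreP n x = 2 / (2 * (n : ℝ) + 1) := by
  have hmonic : ((X ^ 2 - 1) ^ n : ℝ[X]).Monic := by
    rw [← C_1]
    exact (monic_X_pow_sub_C 1 two_ne_zero).pow n
  have htop := hmonic.iterate_derivative_natDegree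
  rw [natDegree_X_sq_sub_one_pow] at htop
  rw [integral_legendreP_mul, ← two_mul, htop]
  simp only [eval_C]
  rw [intervalIntegral.integral_const_mul, integral_sq_sub_one_pow, Nat.factorial_succ]
  have hsign : ((-1 : ℝ) ^ n) * (-1) ^ n = 1 := by rw [← mul_pow]; simp
  push_cast
  field_simp
  linear_combination (2 * (2 ^ n) ^ 2) * hsign

/-- Orthogonality of the Legendre polynomials on `[−1, 1]`:
`∫_{−1}^{1} P_m P_n = 2/(2n+1)` if `m = n` and `0` otherwise. -/
theorem legendre_orthogonality (m n : ℕ) :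
    (∫ x in (-1 : ℝ)..1, legendreP m x * legendreP n x) =
      if m = n then 2 / (2 * (n : ℝ) + 1) else 0 := by
  split_ifs with h
  · rw [h, integral_legendreP_mul_self]
  · rcases lt_or_gt_of_ne h with h | h
    · exact integral_legendreP_mul_of_lt h
    · simpa only [mul_comm] using integral_legendreP_mul_of_lt h
end

section
/- Let t < T be real numbers and let {e_j}_{j∈ℕ} be any Hilbert basis of L²([t, T]). For an integer k ≥ 1 and a multi-index (j₁, …, j_k) ∈ ℕ^k, define C_{j_k…j₁} = ∫_t^T e_{j_k}(t_k) ∫_t^{t_k} e_{j_{k-1}}(t_{k-1}) … ∫_t^{t_2} e_{j_1}(t_1) dt_1 … dt_k (the iterated integral over the ordered simplex). Then Σ_{(j₁,…,j_k)∈ℕ^k} C_{j_k…j₁}² = (T − t)^k / k!. -/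
open MeasureTheory

/-- Iterated integral over the ordered simplex: `iterInt t [f_k, …, f_1] s`
is `∫_t^s f_k(t_k) ∫_t^{t_k} f_{k-1}(t_{k-1}) ⋯ ∫_t^{t_2} f_1(t_1) dt_1 ⋯ dt_k`
(the head of the list is the outermost integrand). -/
noncomputable def iterInt (t : ℝ) : List (ℝ → ℝ) → ℝ → ℝ
  | [], _ => 1
  | f :: fs, s => ∫ x in t..s, f x * iterInt t fs x

theorem continuousOn_iterInt {t T : ℝ} (l : List (ℝ → ℝ))
    (hl : ∀ f ∈ l, IntegrableOn f (Set.Icc t T)) :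
    ContinuousOn (iterInt t l) (Set.Icc t T) := by
  induction l with
  | nil => exact continuousOn_const
  | cons f l ih =>
    rcases lt_or_ge T t with hT | hT
    · simp [Set.Icc_eq_empty_of_lt hT]
    have hi : IntegrableOn (fun x => f x * iterInt t l x) (Set.Icc t T) :=
      (hl f (by simp)).mul_continuousOn
        (ih fun g hg => hl g (List.mem_cons_of_mem _ hg)) isCompact_Icc
    rw [← Set.uIcc_of_le hT] at hi ⊢
    exact intervalIntegral.continuousOn_primitive_interval hi

/-- Parseval's identity on a subinterval `[t, s] ⊆ [t, T]`. -/
theorem HilbertBasis.hasSum_sq_intervalIntegral {ι : Type*} {t T s : ℝ}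
    (e : HilbertBasis ι ℝ (Lp ℝ 2 (volume.restrict (Set.Icc t T))))
    (hs : s ∈ Set.Icc t T) {g : ℝ → ℝ} (hg : MemLp g 2 (volume.restrict (Set.Icc t T))) :
    HasSum (fun j => (∫ x in t..s, (e j : ℝ → ℝ) x * g x) ^ 2) (∫ x in t..s, g x ^ 2) := by
  have hG : MemLp ((Set.Ioc t s).indicator g) 2 (volume.restrict (Set.Icc t T)) :=
    hg.indicator measurableSet_Ioc
  have hsub : Set.Icc t T ∩ Set.Ioc t s = Set.Ioc t s :=
    Set.inter_eq_right.2 fun x hx => ⟨hx.1.le, hx.2.trans hs.2⟩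
  have key (u : ℝ → ℝ) : ∫ x in Set.Icc t T, (Set.Ioc t s).indicator u x = ∫ x in t..s, u x := by
    rw [setIntegral_indicator measurableSet_Ioc, hsub, intervalIntegral.integral_of_le hs.1]
  have hinner (j : ι) : inner ℝ (e j) hG.toLp = ∫ x in t..s, (e j : ℝ → ℝ) x * g x := by
    rw [L2.inner_def, ← key]
    refine integral_congr_ae ?_
    filter_upwards [hG.coeFn_toLp] with x hx
    rw [hx]
    by_cases hx' : x ∈ Set.Ioc t s <;> simp [hx', mul_comm]
  have hself : inner ℝ hG.toLp hG.toLp = ∫ x in t..s, g x ^ 2 := by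
    rw [L2.inner_def, ← key]
    refine integral_congr_ae ?_
    filter_upwards [hG.coeFn_toLp] with x hx
    rw [hx]
    by_cases hx' : x ∈ Set.Ioc t s <;> simp [hx', sq]
  have := e.hasSum_inner_mul_inner hG.toLp hG.toLp
  rw [hself] at this
  simpa only [real_inner_comm (e _), hinner, ← sq] using this

theorem tsum_ofReal_sq_iterInt {ι : Type*} [Countable ι] {t T : ℝ}
    (e : HilbertBasis ι ℝ (Lp ℝ 2 (volume.restrict (Set.Icc t T)))) (k : ℕ) :
    ∀ s ∈ Set.Icc t T,
      ∑' j : Fin k → ι, ENNReal.ofReal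
          ((iterInt t (List.ofFn fun i => (e (j i) : ℝ → ℝ)) s) ^ 2) =
        ENNReal.ofReal ((s - t) ^ k / k.factorial) := by
  induction k with
  | zero => simp [iterInt]
  | succ k ih =>
    intro s hs
    have hle : Set.Ioc t s ⊆ Set.Icc t T := fun x hx => ⟨hx.1.le, hx.2.trans hs.2⟩
    have hint (i : ι) : IntegrableOn (e i : ℝ → ℝ) (Set.Icc t T) :=
      (Lp.memLp (e i)).integrable (by norm_num)
    have hcont (j : Fin k → ι) :
        ContinuousOn (iterInt t (List.ofFn fun i => (e (j i) : ℝ → ℝ))) (Set.Icc t T) :=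
      continuousOn_iterInt _ fun f hf => by
        obtain ⟨i, rfl⟩ := List.mem_ofFn.1 hf
        exact hint _
    have hstep (j : Fin k → ι) :
        ∑' i, ENNReal.ofReal ((∫ x in t..s, (e i : ℝ → ℝ) x *
            iterInt t (List.ofFn fun i => (e (j i) : ℝ → ℝ)) x) ^ 2) =
          ∫⁻ x in Set.Ioc t s, ENNReal.ofReal
            (iterInt t (List.ofFn fun i => (e (j i) : ℝ → ℝ)) x ^ 2) := by
      have hsum := e.hasSum_sq_intervalIntegral hs
        ((memLp_two_iff_integrable_sq ((hcont j).aestronglyMeasurable measurableSet_Icc)).2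
          (((hcont j).pow 2).integrableOn_compact isCompact_Icc))
      rw [← ENNReal.ofReal_tsum_of_nonneg (fun _ => sq_nonneg _) hsum.summable, hsum.tsum_eq,
        intervalIntegral.integral_of_le hs.1, ofReal_integral_eq_lintegral_ofReal]
      · exact (((hcont j).pow 2).integrableOn_compact isCompact_Icc).mono_set hle
      · exact Filter.Eventually.of_forall fun _ => sq_nonneg _
    rw [← (Fin.consEquiv fun _ => ι).tsum_eq, ENNReal.tsum_prod', ENNReal.tsum_comm]
    simp only [Fin.consEquiv_apply, List.ofFn_succ, Fin.cons_zero, Fin.cons_succ, iterInt, hstep]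
    rw [← lintegral_tsum fun j => ((((hcont j).mono hle).aemeasurable
      measurableSet_Ioc).pow_const 2).ennreal_ofReal,
      setLIntegral_congr_fun measurableSet_Ioc fun x hx => ih x (hle hx),
      ← ofReal_integral_eq_lintegral_ofReal, ← intervalIntegral.integral_of_le hs.1]
    · congr 1
      rw [intervalIntegral.integral_div,
        intervalIntegral.integral_comp_sub_right (fun x => x ^ k) t, integral_pow,
        Nat.factorial_succ]
      push_cast
      field_simp
      simp
    · exact (Continuous.integrableOn_Icc (by fun_prop)).mono_set Set.Ioc_subset_Icc_self
    · filter_upwards [ae_restrict_mem measurableSet_Ioc] with x hx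
      have := sub_nonneg.2 hx.1.le
      simp only [Pi.zero_apply]
      positivity

/-- Parseval identity for the kernel `1_{t₁<…<t_k}`: for any Hilbert basis
`{e_j}` of `L²([t,T])`, the squares of the iterated Fourier coefficients
`C_{j_k…j₁}` sum to `(T−t)^k/k!`. -/
theorem parseval_ordered_simplex_kernel (k : ℕ) (hk : 1 ≤ k) (t T : ℝ) (h : t < T)
    (e : HilbertBasis ℕ ℝ (Lp ℝ 2 (volume.restrict (Set.Icc t T)))) :
    ∑' j : Fin k → ℕ,
        (iterInt t (List.ofFn fun i : Fin k => ((e (j i.rev) : Lp ℝ 2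
            (volume.restrict (Set.Icc t T))) : ℝ → ℝ)) T) ^ 2 =
      (T - t) ^ k / (Nat.factorial k) := by
  have key := congrArg ENNReal.toReal (tsum_ofReal_sq_iterInt e k T (Set.right_mem_Icc.2 h.le))
  have hnn : 0 ≤ (T - t) ^ k / (k.factorial : ℝ) := by
    have := sub_nonneg.2 h.le
    positivity
  rw [ENNReal.tsum_toReal_eq fun _ => ENNReal.ofReal_ne_top, ENNReal.toReal_ofReal hnn] at key
  simp only [ENNReal.toReal_ofReal (sq_nonneg _)] at key
  rw [← key, ← (Equiv.arrowCongr Fin.revPerm (Equiv.refl ℕ)).tsum_eq]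
  simp [Equiv.arrowCongr]
end

section
/- Let t < T be real numbers, Δ = T − t, and let {e_j}_{j∈ℕ} be any Hilbert basis of L²([t, T]). For j₁, j₂, j₃ ∈ ℕ define C^{100}_{j₃j₂j₁} = ∫_t^T e_{j₃}(z) ∫_t^z e_{j₂}(y) ∫_t^y (t − x) e_{j₁}(x) dx dy dz, C^{010}_{j₃j₂j₁} = ∫_t^T e_{j₃}(z) ∫_t^z (t − y) e_{j₂}(y) ∫_t^y e_{j₁}(x) dx dy dz, and C^{001}_{j₃j₂j₁} = ∫_t^T (t − z) e_{j₃}(z) ∫_t^z e_{j₂}(y) ∫_t^y e_{j₁}(x) dx dy dz. Then Σ_{(j₁,j₂,j₃)∈ℕ³} (C^{100}_{j₃j₂j₁})² = Δ⁵/60, Σ_{(j₁,j₂,j₃)∈ℕ³} (C^{010}_{j₃j₂j₁})² = Δ⁵/20, and Σ_{(j₁,j₂,j₃)∈ℕ³} (C^{001}_{j₃j₂j₁})² = Δ⁵/10. -/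
open MeasureTheory

/-- Parseval's identity on `[t, T]` for a continuous function cut off at `z`. -/
lemma tsum_ofReal_sq_integral_mul_hilbertBasis {t T z : ℝ}
    (e : HilbertBasis ℕ ℝ (Lp ℝ 2 (volume.restrict (Set.Icc t T))))
    {f : ℝ → ℝ} (hf : ContinuousOn f (Set.Icc t T)) (hz : z ∈ Set.Icc t T) :
    ∑' j, ENNReal.ofReal ((∫ y in t..z, f y * (e j : ℝ → ℝ) y) ^ 2)
      = ∫⁻ y in Set.Ioc t z, ENNReal.ofReal (f y ^ 2) := by
  have hsub : Set.Ioc t z ⊆ Set.Icc t T := fun x hx => ⟨hx.1.le, hx.2.trans hz.2⟩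
  have hfL : MemLp f 2 (volume.restrict (Set.Icc t T)) := by
    obtain ⟨C, hC⟩ := isCompact_Icc.exists_bound_of_continuousOn hf
    exact MemLp.of_bound (hf.aestronglyMeasurable measurableSet_Icc) C
      (ae_restrict_of_forall_mem measurableSet_Icc hC)
  have hg : MemLp ((Set.Ioc t z).indicator f) 2 (volume.restrict (Set.Icc t T)) :=
    hfL.indicator measurableSet_Ioc
  set F := hg.toLp with hF
  have hcoe : ∀ᵐ y ∂(volume.restrict (Set.Icc t T)), F y = (Set.Ioc t z).indicator f y :=
    hg.coeFn_toLp
  have hrestr : (volume.restrict (Set.Icc t T)).restrict (Set.Ioc t z)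
      = volume.restrict (Set.Ioc t z) := by
    rw [Measure.restrict_restrict measurableSet_Ioc, Set.inter_eq_left.mpr hsub]
  have hinner : ∀ j, inner ℝ F (e j) = ∫ y in t..z, f y * (e j : ℝ → ℝ) y := by
    intro j
    rw [L2.inner_def, intervalIntegral.integral_of_le hz.1, ← hrestr,
      ← integral_indicator measurableSet_Ioc]
    refine integral_congr_ae ?_
    filter_upwards [hcoe] with y hy
    rw [hy]
    by_cases hm : y ∈ Set.Ioc t z <;> simp [hm, mul_comm]
  have hself : inner ℝ F F = ∫ y in Set.Ioc t z, f y ^ 2 := by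
    rw [L2.inner_def, ← hrestr, ← integral_indicator measurableSet_Ioc]
    refine integral_congr_ae ?_
    filter_upwards [hcoe] with y hy
    rw [hy]
    by_cases hm : y ∈ Set.Ioc t z <;> simp [hm, pow_two]
  have hsum : HasSum (fun j => (∫ y in t..z, f y * (e j : ℝ → ℝ) y) ^ 2)
      (∫ y in Set.Ioc t z, f y ^ 2) := by
    have := e.hasSum_inner_mul_inner F F
    rw [hself] at this
    refine this.congr_fun fun j => ?_
    rw [real_inner_comm F, hinner, pow_two]
  rw [← ENNReal.ofReal_tsum_of_nonneg (fun _ => sq_nonneg _) hsum.summable, hsum.tsum_eq,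
    ofReal_integral_eq_lintegral_ofReal]
  · exact ((hf.pow 2).integrableOn_Icc).mono_set hsub
  · exact Filter.Eventually.of_forall fun _ => sq_nonneg _

lemma continuousOn_primitive_mul {t T : ℝ} (h : t ≤ T) {u f : ℝ → ℝ}
    (hu : IntegrableOn u (Set.Icc t T)) (hf : ContinuousOn f (Set.Icc t T)) :
    ContinuousOn (fun z => ∫ y in t..z, f y * u y) (Set.Icc t T) := by
  have := hu.continuousOn_mul hf isCompact_Icc
  rw [← Set.uIcc_of_le h] at this ⊢
  exact intervalIntegral.continuousOn_primitive_interval this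

/-- Parseval's identity for the kernel `w₁(x) w₂(y) w₃(z) 1_{x<y<z}`, valued in `ℝ≥0∞`. -/
lemma tsum_ofReal_sq_triple_integral_hilbertBasis {t T : ℝ} (h : t ≤ T)
    (e : HilbertBasis ℕ ℝ (Lp ℝ 2 (volume.restrict (Set.Icc t T))))
    {w₁ w₂ w₃ : ℝ → ℝ} (h₁ : Continuous w₁) (h₂ : Continuous w₂) (h₃ : Continuous w₃) :
    ∑' j : ℕ × ℕ × ℕ, ENNReal.ofReal ((∫ z in t..T, w₃ z * (e j.2.2 : ℝ → ℝ) z *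
        ∫ y in t..z, w₂ y * (e j.2.1 : ℝ → ℝ) y *
          ∫ x in t..y, w₁ x * (e j.1 : ℝ → ℝ) x) ^ 2)
      = ∫⁻ z in Set.Ioc t T, ENNReal.ofReal (w₃ z ^ 2) *
          ∫⁻ y in Set.Ioc t z, ENNReal.ofReal (w₂ y ^ 2) *
            ∫⁻ x in Set.Ioc t y, ENNReal.ofReal (w₁ x ^ 2) := by
  let A (i : ℕ) (y : ℝ) : ℝ := ∫ x in t..y, w₁ x * (e i : ℝ → ℝ) x
  let B (i j : ℕ) (z : ℝ) : ℝ := ∫ y in t..z, w₂ y * A i y * (e j : ℝ → ℝ) y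
  have he (i : ℕ) : IntegrableOn (e i : ℝ → ℝ) (Set.Icc t T) :=
    (Lp.memLp (e i)).integrable (by norm_num)
  have hA (i : ℕ) : ContinuousOn (fun y => w₂ y * A i y) (Set.Icc t T) :=
    h₂.continuousOn.mul (continuousOn_primitive_mul h (he _) h₁.continuousOn)
  have hB (i j : ℕ) : ContinuousOn (fun z => w₃ z * B i j z) (Set.Icc t T) :=
    h₃.continuousOn.mul (continuousOn_primitive_mul h (he _) (hA i))
  have hmeas {f : ℝ → ℝ} (hf : ContinuousOn f (Set.Icc t T)) {z : ℝ} (hz : z ≤ T) :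
      AEMeasurable (fun y => ENNReal.ofReal (f y ^ 2)) (volume.restrict (Set.Ioc t z)) :=
    (((hf.pow 2).mono fun x hx => ⟨hx.1.le, hx.2.trans hz⟩).aemeasurable
      measurableSet_Ioc).ennreal_ofReal
  have hAsum (z : ℝ) (hz : z ∈ Set.Ioc t T) :
      ∑' i, ∑' j, ENNReal.ofReal (B i j z ^ 2)
        = ∫⁻ y in Set.Ioc t z, ENNReal.ofReal (w₂ y ^ 2) *
            ∫⁻ x in Set.Ioc t y, ENNReal.ofReal (w₁ x ^ 2) := by
    simp_rw [B, tsum_ofReal_sq_integral_mul_hilbertBasis e (hA _) (Set.Ioc_subset_Icc_self hz)]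
    rw [← lintegral_tsum fun i => hmeas (hA i) hz.2]
    refine setLIntegral_congr_fun measurableSet_Ioc fun y hy => ?_
    simp only [mul_pow, ENNReal.ofReal_mul (sq_nonneg _), ENNReal.tsum_mul_left]
    rw [tsum_ofReal_sq_integral_mul_hilbertBasis e h₁.continuousOn ⟨hy.1.le, hy.2.trans hz.2⟩]
  calc
    _ = ∑' j : ℕ × ℕ × ℕ, ENNReal.ofReal
          ((∫ z in t..T, w₃ z * B j.1 j.2.1 z * (e j.2.2 : ℝ → ℝ) z) ^ 2) := by
      simp only [B, A, mul_right_comm]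
    _ = ∑' i, ∑' j, ∫⁻ z in Set.Ioc t T, ENNReal.ofReal ((w₃ z * B i j z) ^ 2) := by
      rw [ENNReal.tsum_prod']
      simp_rw [ENNReal.tsum_prod',
        tsum_ofReal_sq_integral_mul_hilbertBasis e (hB _ _) (Set.right_mem_Icc.mpr h)]
    _ = ∫⁻ z in Set.Ioc t T, ∑' i, ∑' j, ENNReal.ofReal ((w₃ z * B i j z) ^ 2) := by
      rw [lintegral_tsum fun i => AEMeasurable.tsum fun j => hmeas (hB i j) le_rfl]
      simp_rw [lintegral_tsum fun j => hmeas (hB _ j) le_rfl]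
    _ = _ := by
      refine setLIntegral_congr_fun measurableSet_Ioc fun z hz => ?_
      simp only [mul_pow, ENNReal.ofReal_mul (sq_nonneg _), ENNReal.tsum_mul_left]
      rw [hAsum z hz]

lemma setLIntegral_Ioc_ofReal_mul_sub_pow {t z : ℝ} (hz : t ≤ z) {c : ℝ} (hc : 0 ≤ c) (n : ℕ) :
    ∫⁻ y in Set.Ioc t z, ENNReal.ofReal (c * (y - t) ^ n)
      = ENNReal.ofReal (c / (n + 1) * (z - t) ^ (n + 1)) := by
  rw [← ofReal_integral_eq_lintegral_ofReal, ← intervalIntegral.integral_of_le hz,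
    intervalIntegral.integral_const_mul,
    intervalIntegral.integral_comp_sub_right (fun x => x ^ n) t, integral_pow]
  · congr 1
    simp
    ring
  · exact (by fun_prop : Continuous fun y : ℝ => c * (y - t) ^ n).integrableOn_Ioc
  · filter_upwards [ae_restrict_mem measurableSet_Ioc] with y hy
    exact mul_nonneg hc (pow_nonneg (sub_nonneg.mpr hy.1.le) n)

lemma setLIntegral_Ioc_ofReal_mul_of_eq {t z : ℝ} (hz : t ≤ z) {v : ℝ → ℝ} {I : ℝ → ENNReal}
    {m n : ℕ} {c : ℝ} (hc : 0 ≤ c) (hv : ∀ y, v y = (y - t) ^ m)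
    (hI : ∀ y, t ≤ y → I y = ENNReal.ofReal (c * (y - t) ^ n)) :
    ∫⁻ y in Set.Ioc t z, ENNReal.ofReal (v y) * I y
      = ENNReal.ofReal (c / ((m + n : ℕ) + 1) * (z - t) ^ (m + n + 1)) := by
  rw [← setLIntegral_Ioc_ofReal_mul_sub_pow hz hc]
  refine setLIntegral_congr_fun measurableSet_Ioc fun y hy => ?_
  rw [hI y hy.1.le, hv, ← ENNReal.ofReal_mul (pow_nonneg (sub_nonneg.mpr hy.1.le) m)]
  congr 1
  ring

/-- Parseval's identity for the kernel `w₁(x) w₂(y) w₃(z) 1_{x<y<z}` when each `wᵢ` is, up to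
sign, a power of the distance to `t`. -/
lemma tsum_sq_triple_integral_hilbertBasis_of_sq_eq_pow {t T : ℝ} (h : t ≤ T)
    (e : HilbertBasis ℕ ℝ (Lp ℝ 2 (volume.restrict (Set.Icc t T))))
    {w₁ w₂ w₃ : ℝ → ℝ} (h₁ : Continuous w₁) (h₂ : Continuous w₂) (h₃ : Continuous w₃)
    {a b c : ℕ} (ha : ∀ x, w₁ x ^ 2 = (x - t) ^ a) (hb : ∀ x, w₂ x ^ 2 = (x - t) ^ b)
    (hc : ∀ x, w₃ x ^ 2 = (x - t) ^ c) :
    ∑' j : ℕ × ℕ × ℕ, (∫ z in t..T, w₃ z * (e j.2.2 : ℝ → ℝ) z *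
        ∫ y in t..z, w₂ y * (e j.2.1 : ℝ → ℝ) y *
          ∫ x in t..y, w₁ x * (e j.1 : ℝ → ℝ) x) ^ 2
      = (T - t) ^ (a + b + c + 3) / ((a + 1) * (a + b + 2) * (a + b + c + 3)) := by
  have key := tsum_ofReal_sq_triple_integral_hilbertBasis h e h₁ h₂ h₃
  have h1 (y : ℝ) (hy : t ≤ y) : ∫⁻ x in Set.Ioc t y, ENNReal.ofReal (w₁ x ^ 2)
      = ENNReal.ofReal (1 / (a + 1) * (y - t) ^ (a + 1)) := by
    rw [← setLIntegral_Ioc_ofReal_mul_sub_pow hy zero_le_one]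
    simp only [ha, one_mul]
  rw [setLIntegral_Ioc_ofReal_mul_of_eq h (by positivity) hc fun z hz =>
    setLIntegral_Ioc_ofReal_mul_of_eq hz (by positivity) hb h1] at key
  have := congrArg ENNReal.toReal key
  rw [ENNReal.tsum_toReal_eq fun _ => ENNReal.ofReal_ne_top, ENNReal.toReal_ofReal
    (mul_nonneg (by positivity) (pow_nonneg (sub_nonneg.mpr h) _))] at this
  simp only [ENNReal.toReal_ofReal (sq_nonneg _)] at this
  rw [this, show c + (b + (a + 1) + 1) + 1 = a + b + c + 3 by ring]
  push_cast
  field_simp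
  ring

/-- Parseval identities for the kernels `(t−t₁)1_{t₁<t₂<t₃}`, `(t−t₂)1_{t₁<t₂<t₃}`,
`(t−t₃)1_{t₁<t₂<t₃}`: for any Hilbert basis `{e_j}` of `L²([t,T])`, the squares of
the weighted triple Fourier coefficients `C^{100}`, `C^{010}`, `C^{001}` sum to
`Δ⁵/60`, `Δ⁵/20`, `Δ⁵/10` respectively. -/
theorem parseval_weighted_triple_kernels (t T : ℝ) (h : t < T)
    (e : HilbertBasis ℕ ℝ (Lp ℝ 2 (volume.restrict (Set.Icc t T)))) :
    (∑' j : ℕ × ℕ × ℕ,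
        (∫ z in t..T, (e j.2.2 : ℝ → ℝ) z *
          ∫ y in t..z, (e j.2.1 : ℝ → ℝ) y *
            ∫ x in t..y, (t - x) * (e j.1 : ℝ → ℝ) x) ^ 2)
        = (T - t) ^ 5 / 60 ∧
    (∑' j : ℕ × ℕ × ℕ,
        (∫ z in t..T, (e j.2.2 : ℝ → ℝ) z *
          ∫ y in t..z, (t - y) * (e j.2.1 : ℝ → ℝ) y *
            ∫ x in t..y, (e j.1 : ℝ → ℝ) x) ^ 2)
        = (T - t) ^ 5 / 20 ∧
    (∑' j : ℕ × ℕ × ℕ,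
        (∫ z in t..T, (t - z) * (e j.2.2 : ℝ → ℝ) z *
          ∫ y in t..z, (e j.2.1 : ℝ → ℝ) y *
            ∫ x in t..y, (e j.1 : ℝ → ℝ) x) ^ 2)
        = (T - t) ^ 5 / 10 := by
  have hsq (x : ℝ) : (t - x) ^ 2 = (x - t) ^ 2 := by ring
  have hone (x : ℝ) : (1 : ℝ) ^ 2 = (x - t) ^ 0 := by simp
  have hw : Continuous fun x : ℝ => t - x := by fun_prop
  have h1 : Continuous fun _ : ℝ => (1 : ℝ) := continuous_const
  refine ⟨?_, ?_, ?_⟩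
  · have := tsum_sq_triple_integral_hilbertBasis_of_sq_eq_pow h.le e hw h1 h1 hsq hone hone
    norm_num at this
    exact this
  · have := tsum_sq_triple_integral_hilbertBasis_of_sq_eq_pow h.le e h1 hw h1 hone hsq hone
    norm_num at this
    exact this
  · have := tsum_sq_triple_integral_hilbertBasis_of_sq_eq_pow h.le e h1 h1 hw hone hone hsq
    norm_num at this
    exact this
end
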